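/- Let A be an abelian category, let M be an object, let N = ⊕_{k=1}^{n} N_k be a finite biproduct decomposition with injections t_k : N_k ⟶ N, and let 0 ⟶ F →i N →d C ⟶ 0 be a fully invariant short exact sequence. For each k let F ∩ N_k be the pullback of i and t_k, with projection u_k : F ∩ N_k ⟶ N_k (which is a fully invariant monomorphism). Then N is M-F-split if and only if for every k ∈ {1, …, n}, N_k is M-(F ∩ N_k)-split, i.e., for every morphism g : M ⟶ N_k the kernel of d_k ∘ g is a split monomorphism, where d_k : N_k ⟶ C_k is the cokernel of u_k. -/

import Mathlib

open CategoryTheory CategoryTheory.Limits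

attribute [local instance] CategoryTheory.Abelian.hasFiniteBiproducts

universe v u

/-- A monomorphism `i : F ⟶ M` is *fully invariant* if for each endomorphism
`h : M ⟶ M` there is `α : F ⟶ F` with `h ∘ i = i ∘ α`. -/
def FullyInvariant {A : Type u} [Category.{v} A] {F M : A} (i : F ⟶ M) : Prop :=
  ∀ h : M ⟶ M, ∃ α : F ⟶ F, i ≫ h = α ≫ i

/-- The kernel of `f` splits iff some endomorphism of the source lands in the kernel and fixes
every morphism annihilated by `f`. -/
theorem isSplitMono_kernel_ι_iff {A : Type u} [Category.{v} A] [Abelian A] {M C : A} (f : M ⟶ C) :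
    IsSplitMono (kernel.ι f) ↔
      ∃ e : M ⟶ M, e ≫ f = 0 ∧ ∀ (X : A) (x : X ⟶ M), x ≫ f = 0 → x ≫ e = x := by
  constructor
  · intro h
    refine ⟨retraction (kernel.ι f) ≫ kernel.ι f, by simp, fun X x hx => ?_⟩
    rw [← kernel.lift_ι f x hx, Category.assoc, IsSplitMono.id_assoc]
  · rintro ⟨e, he, h⟩
    refine ⟨⟨⟨kernel.lift f e he, ?_⟩⟩⟩
    rw [← cancel_mono (kernel.ι f), Category.assoc, kernel.lift_ι, Category.id_comp]
    exact h _ _ (kernel.condition f)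

/-- Morphisms with the same annihilated morphisms have simultaneously split kernels. -/
theorem isSplitMono_kernel_ι_congr {A : Type u} [Category.{v} A] [Abelian A] {M C C' : A}
    {f : M ⟶ C} {f' : M ⟶ C'} (h : ∀ (X : A) (x : X ⟶ M), x ≫ f = 0 ↔ x ≫ f' = 0) :
    IsSplitMono (kernel.ι f) ↔ IsSplitMono (kernel.ι f') := by
  simp only [isSplitMono_kernel_ι_iff, h]

/-- If all `a ≫ f k` with `a` an endomorphism have split kernels, then the intersection of the
kernels of finitely many `f k` is the image of an endomorphism fixing it. -/
theorem exists_endomorphism_fixing_common_kernel {A : Type u} [Category.{v} A] [Abelian A]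
    {ι : Type*} {M : A} {C : ι → A} (f : ∀ k, M ⟶ C k)
    (h : ∀ k (a : M ⟶ M), IsSplitMono (kernel.ι (a ≫ f k))) (s : Finset ι) :
    ∃ e : M ⟶ M, (∀ k ∈ s, e ≫ f k = 0) ∧
      ∀ (X : A) (x : X ⟶ M), (∀ k ∈ s, x ≫ f k = 0) → x ≫ e = x := by
  classical
  induction s using Finset.induction_on with
  | empty => exact ⟨𝟙 M, by simp, by simp⟩
  | insert k s _ ih =>
    obtain ⟨e, he, hfix⟩ := ih
    obtain ⟨e', he', hfix'⟩ := (isSplitMono_kernel_ι_iff _).1 (h k e)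
    refine ⟨e' ≫ e, fun j hj => ?_, fun X x hx => ?_⟩
    · rcases Finset.mem_insert.1 hj with rfl | hj
      · simpa using he'
      · rw [Category.assoc, he j hj, comp_zero]
    · have hxe := hfix X x fun j hj => hx j (Finset.mem_insert_of_mem hj)
      have hxe' := hfix' X x (by
        rw [← Category.assoc, hxe]
        exact hx k (Finset.mem_insert_self k s))
      rw [← Category.assoc, hxe', hxe]

/-- A morphism is annihilated by the cokernel of the base change of the kernel of `d` along `t`
iff it is annihilated by `t ≫ d`. -/
theorem comp_cokernel_π_pullback_snd_eq_zero_iff {A : Type u} [Category.{v} A] [Abelian A]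
    {F N C N' : A} {i : F ⟶ N} {d : N ⟶ C} {w : i ≫ d = 0}
    (hse : (ShortComplex.mk i d w).ShortExact) (t : N' ⟶ N) {X : A} (y : X ⟶ N') :
    y ≫ cokernel.π (pullback.snd i t) = 0 ↔ y ≫ t ≫ d = 0 := by
  have : Mono i := hse.mono_f
  constructor
  · intro h
    have hu : pullback.snd i t ≫ t ≫ d = 0 := by
      rw [← pullback.condition_assoc, w, comp_zero]
    rw [← cokernel.π_desc _ _ hu, ← Category.assoc, h, zero_comp]
  · intro h
    have hy : (y ≫ t) ≫ d = 0 := by rwa [Category.assoc]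
    rw [← pullback.lift_snd (hse.exact.lift (y ≫ t) hy) y (hse.exact.lift_f (y ≫ t) hy),
      Category.assoc, cokernel.condition, comp_zero]

/-- A morphism to a biproduct lies in a fully invariant subobject iff its components do. -/
theorem FullyInvariant.comp_eq_zero_iff {A : Type u} [Category.{v} A] [Abelian A] {n : ℕ}
    {N_ : Fin n → A} {F C : A} {i : F ⟶ ⨁ N_} {d : (⨁ N_) ⟶ C} {w : i ≫ d = 0}
    (hi : FullyInvariant i) (hse : (ShortComplex.mk i d w).ShortExact) {X : A} (y : X ⟶ ⨁ N_) :
    y ≫ d = 0 ↔ ∀ k, y ≫ biproduct.π N_ k ≫ biproduct.ι N_ k ≫ d = 0 := by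
  have : Mono i := hse.mono_f
  constructor
  · intro h k
    obtain ⟨α, hα⟩ := hi (biproduct.π N_ k ≫ biproduct.ι N_ k)
    have hy : hse.exact.lift y h ≫ i = y := hse.exact.lift_f y h
    rw [← hy, Category.assoc, reassoc_of% hα, w, comp_zero, comp_zero]
  · intro h
    rw [← Category.comp_id y, ← biproduct.total, Preadditive.comp_sum, Preadditive.sum_comp]
    exact Finset.sum_eq_zero fun k _ => by simpa using h k

/-- Let `N = ⨁ N_k` be a finite biproduct and `0 ⟶ F ⟶ N ⟶ C ⟶ 0` a fully
invariant short exact sequence. Then `N` is `M`-`F`-split iff each `N_k` is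
`M`-`(F ∩ N_k)`-split: for every `g : M ⟶ N_k` the kernel of `d_k ∘ g` is a
split monomorphism, where `d_k` is the cokernel of the pullback projection
`u_k : F ∩ N_k ⟶ N_k` of `i` and the biproduct injection. -/
theorem stmt_16 {A : Type u} [Category.{v} A] [Abelian A] {n : ℕ}
    (N_ : Fin n → A) (M F C : A) (i : F ⟶ ⨁ N_) (d : (⨁ N_) ⟶ C)
    (w : i ≫ d = 0) (hse : (ShortComplex.mk i d w).ShortExact)
    (hi : FullyInvariant i) :
    (∀ g : M ⟶ ⨁ N_, IsSplitMono (kernel.ι (g ≫ d))) ↔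
      ∀ (k : Fin n) (g : M ⟶ N_ k),
        IsSplitMono (kernel.ι (g ≫ cokernel.π (pullback.snd i (biproduct.ι N_ k)))) := by
  constructor
  · intro h k g
    refine (isSplitMono_kernel_ι_congr fun X x => ?_).1 (h (g ≫ biproduct.ι N_ k))
    simpa using (comp_cokernel_π_pullback_snd_eq_zero_iff hse (biproduct.ι N_ k) (x ≫ g)).symm
  · intro h g
    obtain ⟨e, he, hfix⟩ := exists_endomorphism_fixing_common_kernel
      (fun k => (g ≫ biproduct.π N_ k) ≫ cokernel.π (pullback.snd i (biproduct.ι N_ k)))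
      (fun k a => (isSplitMono_kernel_ι_congr fun X x => by simp only [Category.assoc]).1
        (h k (a ≫ g ≫ biproduct.π N_ k)))
      Finset.univ
    have key : ∀ (X : A) (x : X ⟶ M), x ≫ g ≫ d = 0 ↔ ∀ k ∈ Finset.univ,
        x ≫ (g ≫ biproduct.π N_ k) ≫ cokernel.π (pullback.snd i (biproduct.ι N_ k)) = 0 := by
      intro X x
      simp only [← Category.assoc x, comp_cokernel_π_pullback_snd_eq_zero_iff hse,
        hi.comp_eq_zero_iff hse, Finset.mem_univ, true_imp_iff]
      simp only [Category.assoc]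
    exact (isSplitMono_kernel_ι_iff _).2 ⟨e, (key M e).2 he, fun X x hx =>
      hfix X x ((key X x).1 hx)⟩
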